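/- Let u ∈ {0,1}^ℕ and σ ∈ {L,M,R}* satisfy inf O(u) ≥ inf O(σ(1 0̄)) and sup O(u) ≤ sup O(σ(0 1̄)) in the lexicographic order. Then either u ends with σ(v) for some v ∈ {0,1}^ℕ (i.e. u = p·σ(v) for some finite word p), or u ends with σ'(0̄) for some σ' ∈ {L,M,R}*M such that σ = σ'∘τ for some τ ∈ {L,M,R}*. -/

import Mathlib

/-- `π_β(u)` for a binary sequence `u = u₁u₂⋯` (indexed from 0). -/
noncomputable def piB (β : ℝ) (u : ℕ → Bool) : ℝ :=
  ∑' k : ℕ, (if u k then (1 : ℝ) else 0) / β ^ (k + 1)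

/-- `π_β(u)` for a real digit sequence. -/
noncomputable def piR (β : ℝ) (u : ℕ → ℝ) : ℝ := ∑' k : ℕ, u k / β ^ (k + 1)

/-- A binary sequence viewed as a real digit sequence. -/
def bR (u : ℕ → Bool) : ℕ → ℝ := fun k => if u k then 1 else 0

/-- `U_β(A)`: sequences with digits in `A` whose `π_β`-value has no other expansion over `A`. -/
def Uset (β : ℝ) (A : Set ℝ) : Set (ℕ → ℝ) :=
  {u | (∀ k, u k ∈ A) ∧ ∀ v : ℕ → ℝ, (∀ k, v k ∈ A) → v ≠ u → piR β v ≠ piR β u}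

/-- `𝓛(m) = inf {β > 1 : U_β(m) ∩ {0,1}^ℕ is uncountable}`. -/
noncomputable def Lval (m : ℝ) : ℝ :=
  sInf {β : ℝ | 1 < β ∧ ¬ (Uset β {0, 1, m} ∩ {v | ∃ u : ℕ → Bool, v = bR u}).Countable}

/-- The shift orbit `O(u)` of an infinite binary word. -/
def orbit (u : ℕ → Bool) : Set (ℕ → Bool) := {v | ∃ k : ℕ, v = fun i => u (i + k)}

/-- Suffixes of `u` preceded by the letter `1`. -/
def orbit1 (u : ℕ → Bool) : Set (ℕ → Bool) :=
  {v | ∃ k : ℕ, u k = true ∧ v = fun i => u (i + k + 1)}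

/-- Suffixes of `u` preceded by the letter `0`. -/
def orbit0 (u : ℕ → Bool) : Set (ℕ → Bool) :=
  {v | ∃ k : ℕ, u k = false ∧ v = fun i => u (i + k + 1)}

open Classical in
/-- The lexicographic supremum of a set of binary sequences (greedy construction);
`⊥ = 0̄` for the empty set. -/
noncomputable def lexSupSeq (S : Set (ℕ → Bool)) : ℕ → Bool
  | n => decide (∃ u ∈ S, (∀ i, i < n → u i = lexSupSeq S i) ∧ u n = true)
  termination_by n => n

open Classical in
/-- The lexicographic infimum of a set of binary sequences (greedy construction);
`⊤ = 1̄` for the empty set. -/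
noncomputable def lexInfSeq (S : Set (ℕ → Bool)) : ℕ → Bool
  | n => decide (¬ ∃ u ∈ S, (∀ i, i < n → u i = lexInfSeq S i) ∧ u n = false)
  termination_by n => n

/-- `sup O(u)`, the lexicographically largest limit of suffixes of `u`. -/
noncomputable def supO (u : ℕ → Bool) : ℕ → Bool := lexSupSeq (orbit u)
/-- `inf O(u)`. -/
noncomputable def infO (u : ℕ → Bool) : ℕ → Bool := lexInfSeq (orbit u)
/-- `sup₀(u)`, the supremum of the suffixes preceded by `0`. -/
noncomputable def sup0 (u : ℕ → Bool) : ℕ → Bool := lexSupSeq (orbit0 u)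
/-- `inf₁(u)`, the infimum of the suffixes preceded by `1`. -/
noncomputable def inf1 (u : ℕ → Bool) : ℕ → Bool := lexInfSeq (orbit1 u)

/-- Strict lexicographic order on infinite binary words. -/
def lexLt (u v : ℕ → Bool) : Prop := ∃ n, (∀ i, i < n → u i = v i) ∧ u n < v n
/-- Lexicographic order on infinite binary words. -/
def lexLe (u v : ℕ → Bool) : Prop := lexLt u v ∨ u = v

/-- `f_u(m)`: the unique `β ≥ 1` with `β·π_β(sup O(u)) = m`. -/
noncomputable def fVal (u : ℕ → Bool) (m : ℝ) : ℝ :=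
  sInf {β : ℝ | 1 ≤ β ∧ β * piB β (supO u) = m}

/-- `g_u(m)`: the unique `β > 1` with `(β-1)(1+π_β(inf O(u))) = m`. -/
noncomputable def gVal (u : ℕ → Bool) (m : ℝ) : ℝ :=
  sInf {β : ℝ | 1 < β ∧ (β - 1) * (1 + piB β (infO u)) = m}

/-- `μ_u`: the unique `m ∈ (1,2]` with `f_u(m) = g_u(m)`. -/
noncomputable def muVal (u : ℕ → Bool) : ℝ :=
  sInf {m : ℝ | 1 < m ∧ m ≤ 2 ∧ fVal u m = gVal u m}

/-- `u` contains at least two ones. -/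
def TwoOnes (u : ℕ → Bool) : Prop := ∃ k l, k < l ∧ u k = true ∧ u l = true

/-- The substitution `L : 0 ↦ 0, 1 ↦ 01` (with `0 = false`, `1 = true`). -/
def Lsub : Bool → List Bool := fun b => if b then [false, true] else [false]
/-- The substitution `M : 0 ↦ 01, 1 ↦ 10`. -/
def Msub : Bool → List Bool := fun b => if b then [true, false] else [false, true]
/-- The substitution `R : 0 ↦ 01, 1 ↦ 1`. -/
def Rsub : Bool → List Bool := fun b => if b then [true] else [false, true]
/-- The identity substitution. -/
def idSub : Bool → List Bool := fun b => [b]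
/-- Composition of substitutions: `compSub σ τ = σ ∘ τ` (apply `τ` first). -/
def compSub (σ τ : Bool → List Bool) : Bool → List Bool := fun b => (τ b).flatMap σ

/-- The monoid `{L,M,R}*` generated by the three substitutions. -/
def LMRstar : Set (Bool → List Bool) :=
  {σ | ∃ l : List (Bool → List Bool),
    (∀ τ ∈ l, τ = Lsub ∨ τ = Msub ∨ τ = Rsub) ∧ σ = l.foldr compSub idSub}

/-- A substitution applied to an infinite word, `σ(u₁)σ(u₂)⋯`. -/
noncomputable def substApply (σ : Bool → List Bool) (u : ℕ → Bool) : ℕ → Bool := fun n =>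
  let k := sSup {k : ℕ | (∑ i ∈ Finset.range k, (σ (u i)).length) ≤ n}
  (σ (u k)).getD (n - ∑ i ∈ Finset.range k, (σ (u i)).length) false

/-- `u` is a limit word of the sequence of substitutions `σseq`. -/
def IsLimitWord (σseq : ℕ → Bool → List Bool) (u : ℕ → Bool) : Prop :=
  ∃ useq : ℕ → ℕ → Bool, useq 0 = u ∧ ∀ n, useq n = substApply (σseq n) (useq (n + 1))

/-- Primitivity of a sequence of substitutions in `{L,M,R}^ℕ`: no tail is constantly `L`
and no tail is constantly `R`. -/
def PrimitiveSeq (σseq : ℕ → Bool → List Bool) : Prop :=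
  (¬ ∃ k, ∀ n, k ≤ n → σseq n = Lsub) ∧ ¬ ∃ k, ∀ n, k ≤ n → σseq n = Rsub

/-- `S_{L,M,R}`: the set of limit words of primitive sequences of substitutions. -/
def Sset : Set (ℕ → Bool) :=
  {u | ∃ σseq : ℕ → Bool → List Bool,
    (∀ n, σseq n = Lsub ∨ σseq n = Msub ∨ σseq n = Rsub) ∧
    PrimitiveSeq σseq ∧ IsLimitWord σseq u}

/-- The word `1 0̄ = 1000⋯`. -/
def w10bar : ℕ → Bool := fun n => decide (n = 0)
/-- The word `0 1̄ = 0111⋯`. -/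
def w01bar : ℕ → Bool := fun n => decide (n ≠ 0)
/-- The word `01 0̄ = 01000⋯`. -/
def w010bar : ℕ → Bool := fun n => decide (n = 1)
/-- The word `10 1̄ = 10111⋯`. -/
def w101bar : ℕ → Bool := fun n => decide (n ≠ 1)
/-- The word `0̄`. -/
def w0bar : ℕ → Bool := fun _ => false
/-- The word `1̄`. -/
def w1bar : ℕ → Bool := fun _ => true

/-- Prepend a letter to an infinite word. -/
def consB (b : Bool) (u : ℕ → Bool) : ℕ → Bool := fun n =>
  match n with
  | 0 => b
  | Nat.succ k => u k

/-- Prepend a finite word to an infinite word. -/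
def appendW (w : List Bool) (v : ℕ → Bool) : ℕ → Bool := fun n =>
  if n < w.length then w.getD n false else v (n - w.length)

/-- The suffix of an infinite word obtained by dropping its first `k` letters. -/
def dropW (k : ℕ) (u : ℕ → Bool) : ℕ → Bool := fun i => u (i + k)

theorem dropW_zero (u : ℕ → Bool) : dropW 0 u = u := rfl

theorem dropW_dropW (j k : ℕ) (u : ℕ → Bool) : dropW j (dropW k u) = dropW (j + k) u := by
  funext i
  simp [dropW, Nat.add_assoc]

theorem dropW_succ_consB (k : ℕ) (b : Bool) (u : ℕ → Bool) :
    dropW (k + 1) (consB b u) = dropW k u := rfl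

theorem dropW_eq_consB (k : ℕ) (u : ℕ → Bool) :
    dropW k u = consB (u k) (dropW (k + 1) u) := by
  funext i
  cases i with
  | zero => simp [dropW, consB]
  | succ n => simp only [dropW, consB]; congr 1; omega

theorem eq_consB (u : ℕ → Bool) : u = consB (u 0) (dropW 1 u) := dropW_eq_consB 0 u

theorem appendW_nil (v : ℕ → Bool) : appendW [] v = v := by
  funext n
  simp [appendW]

theorem appendW_cons (a : Bool) (w : List Bool) (v : ℕ → Bool) :
    appendW (a :: w) v = consB a (appendW w v) := by
  funext n
  cases n with
  | zero => simp [appendW, consB]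
  | succ n => simp [appendW, consB]

theorem appendW_append (p q : List Bool) (v : ℕ → Bool) :
    appendW (p ++ q) v = appendW p (appendW q v) := by
  induction p with
  | nil => simp [appendW_nil]
  | cons a p ih => simp [appendW_cons, ih]

theorem exists_appendW_dropW (k : ℕ) (u : ℕ → Bool) :
    ∃ p, u = appendW p (dropW k u) := by
  induction k with
  | zero => exact ⟨[], (appendW_nil _).symm⟩
  | succ k ih =>
    obtain ⟨p, hp⟩ := ih
    refine ⟨p ++ [u k], ?_⟩
    rw [appendW_append, appendW_cons, appendW_nil, ← dropW_eq_consB]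
    exact hp

theorem dropW_length_appendW (p : List Bool) (v : ℕ → Bool) :
    dropW p.length (appendW p v) = v := by
  induction p with
  | nil => rw [appendW_nil]; rfl
  | cons a p ih => rw [appendW_cons, List.length_cons, dropW_succ_consB, ih]

/-! ### The lexicographic order -/

theorem lexLe_iff {u v : ℕ → Bool} : lexLe u v ↔ toLex u ≤ toLex v := by
  rw [le_iff_lt_or_eq, toLex_inj]
  exact Iff.rfl

theorem lexLe_refl (u : ℕ → Bool) : lexLe u u := Or.inr rfl

theorem lexLe_trans {u v w : ℕ → Bool} (h : lexLe u v) (h' : lexLe v w) : lexLe u w := by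
  rw [lexLe_iff] at *
  exact h.trans h'

theorem not_lexLe {u v : ℕ → Bool} : ¬ lexLe u v ↔ lexLt v u := by
  rw [lexLe_iff, not_le]
  exact Iff.rfl

theorem not_lexLt {u v : ℕ → Bool} : ¬ lexLt u v ↔ lexLe v u := by
  rw [← not_lexLe, not_not]

theorem lexLt_consB_self {b : Bool} {u v : ℕ → Bool} :
    lexLt (consB b u) (consB b v) ↔ lexLt u v := by
  constructor
  · rintro ⟨n, h, hn⟩
    cases n with
    | zero => simp [consB] at hn
    | succ n => exact ⟨n, fun i hi => h (i + 1) (by omega), hn⟩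
  · rintro ⟨n, h, hn⟩
    refine ⟨n + 1, fun i hi => ?_, hn⟩
    cases i with
    | zero => rfl
    | succ i => exact h i (by omega)

theorem lexLe_consB_self {b : Bool} {u v : ℕ → Bool} :
    lexLe (consB b u) (consB b v) ↔ lexLe u v := by
  rw [← not_lexLt, ← not_lexLt, lexLt_consB_self]

theorem lexLt_false_true (u v : ℕ → Bool) : lexLt (consB false u) (consB true v) :=
  ⟨0, by simp, by simp [consB]⟩

theorem lexLe_false_true (u v : ℕ → Bool) : lexLe (consB false u) (consB true v) :=
  Or.inl (lexLt_false_true u v)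

theorem not_lexLe_true_false (u v : ℕ → Bool) : ¬ lexLe (consB true u) (consB false v) :=
  not_lexLe.2 (lexLt_false_true v u)

theorem w0bar_lexLe (u : ℕ → Bool) : lexLe w0bar u := by
  rw [← not_lexLt]
  rintro ⟨n, -, hn⟩
  simp [w0bar, Bool.lt_iff] at hn

theorem lexLe_w1bar (u : ℕ → Bool) : lexLe u w1bar := by
  rw [← not_lexLt]
  rintro ⟨n, -, hn⟩
  simp [w1bar, Bool.lt_iff] at hn

theorem consB_false_lexLe (u : ℕ → Bool) : lexLe (consB false u) u := by
  rw [← not_lexLt]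
  rintro ⟨n, h, hn⟩
  have key : ∀ i, i ≤ n → consB false u i = false := by
    intro i
    induction i with
    | zero => intro _; rfl
    | succ i ih => intro hi; rw [← ih (by omega)]; exact h i (by omega)
  simp [key n le_rfl, Bool.lt_iff] at hn

theorem lexLe_consB_true (u : ℕ → Bool) : lexLe u (consB true u) := by
  rw [← not_lexLt]
  rintro ⟨n, h, hn⟩
  have key : ∀ i, i ≤ n → consB true u i = true := by
    intro i
    induction i with
    | zero => intro _; rfl
    | succ i ih => intro hi; rw [← ih (by omega)]; exact (h i (by omega)).symm
  simp [key n le_rfl, Bool.lt_iff] at hn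

/-- Two distinct words compare at the first letter where they differ. -/
theorem exists_first_ne {u v : ℕ → Bool} (h : u ≠ v) :
    ∃ n, (∀ i, i < n → u i = v i) ∧ u n ≠ v n := by
  classical
  have h' : ∃ n, u n ≠ v n := Function.ne_iff.1 h
  exact ⟨Nat.find h', fun i hi => not_not.1 (Nat.find_min h' hi), Nat.find_spec h'⟩

theorem lexInfSeq_lexLe {S : Set (ℕ → Bool)} {x : ℕ → Bool} (hx : x ∈ S) :
    lexLe (lexInfSeq S) x := by
  by_cases h : lexInfSeq S = x
  · exact Or.inr h
  obtain ⟨n, hn, hne⟩ := exists_first_ne h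
  refine Or.inl ⟨n, hn, ?_⟩
  cases hxn : x n with
  | false =>
    refine absurd ?_ hne
    rw [lexInfSeq, hxn, decide_eq_false_iff_not, not_not]
    exact ⟨x, hx, fun i hi => (hn i hi).symm, hxn⟩
  | true =>
    rw [hxn] at hne
    simp [Bool.lt_iff, hne]

theorem lexLe_lexInfSeq {S : Set (ℕ → Bool)} {a : ℕ → Bool} (h : ∀ x ∈ S, lexLe a x) :
    lexLe a (lexInfSeq S) := by
  by_contra hlt
  obtain ⟨n, hn, hne⟩ := not_lexLe.1 hlt
  rw [Bool.lt_iff] at hne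
  have h0 := hne.1
  rw [lexInfSeq, decide_eq_false_iff_not, not_not] at h0
  obtain ⟨x, hx, hxi, hxn⟩ := h0
  refine not_lexLe.2 ⟨n, fun i hi => (hxi i hi).trans (hn i hi), ?_⟩ (h x hx)
  rw [hxn, hne.2]
  decide

theorem lexLe_lexSupSeq {S : Set (ℕ → Bool)} {x : ℕ → Bool} (hx : x ∈ S) :
    lexLe x (lexSupSeq S) := by
  classical
  by_cases h : x = lexSupSeq S
  · exact Or.inr h
  obtain ⟨n, hn, hne⟩ := exists_first_ne h
  refine Or.inl ⟨n, hn, ?_⟩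
  cases hxn : x n with
  | true =>
    refine absurd (Eq.symm ?_) hne
    rw [lexSupSeq, hxn, decide_eq_true_iff]
    exact ⟨x, hx, hn, hxn⟩
  | false =>
    rw [hxn] at hne
    simp [Bool.lt_iff, hne.symm]

theorem lexSupSeq_lexLe {S : Set (ℕ → Bool)} {b : ℕ → Bool} (h : ∀ x ∈ S, lexLe x b) :
    lexLe (lexSupSeq S) b := by
  classical
  by_contra hlt
  obtain ⟨n, hn, hne⟩ := not_lexLe.1 hlt
  rw [Bool.lt_iff] at hne
  have h0 := hne.2
  rw [lexSupSeq, decide_eq_true_iff] at h0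
  obtain ⟨x, hx, hxi, hxn⟩ := h0
  refine not_lexLe.2 ⟨n, fun i hi => (hn i hi).trans (hxi i hi).symm, ?_⟩ (h x hx)
  rw [hxn, hne.1]
  decide

theorem infO_lexLe_dropW (u : ℕ → Bool) (k : ℕ) : lexLe (infO u) (dropW k u) :=
  lexInfSeq_lexLe ⟨k, rfl⟩

theorem dropW_lexLe_supO (u : ℕ → Bool) (k : ℕ) : lexLe (dropW k u) (supO u) :=
  lexLe_lexSupSeq ⟨k, rfl⟩

theorem lexLe_infO {a u : ℕ → Bool} (h : ∀ k, lexLe a (dropW k u)) : lexLe a (infO u) :=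
  lexLe_lexInfSeq (by rintro x ⟨k, rfl⟩; exact h k)

theorem supO_lexLe {b u : ℕ → Bool} (h : ∀ k, lexLe (dropW k u) b) : lexLe (supO u) b :=
  lexSupSeq_lexLe (by rintro x ⟨k, rfl⟩; exact h k)

/-! ### Nonerasing substitutions acting on infinite words -/

/-- A substitution is nonerasing if no letter has an empty image. -/
def Nonerasing (σ : Bool → List Bool) : Prop := ∀ b, σ b ≠ []

theorem substApply_apply {σ : Bool → List Bool} {u : ℕ → Bool} {n k : ℕ}
    (h₁ : ∑ i ∈ Finset.range k, (σ (u i)).length ≤ n)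
    (h₂ : n < ∑ i ∈ Finset.range (k + 1), (σ (u i)).length) :
    substApply σ u n = (σ (u k)).getD (n - ∑ i ∈ Finset.range k, (σ (u i)).length) false := by
  have hk : sSup {k : ℕ | (∑ i ∈ Finset.range k, (σ (u i)).length) ≤ n} = k := by
    refine IsGreatest.csSup_eq ⟨h₁, fun m hm => ?_⟩
    by_contra hlt
    have : ∑ i ∈ Finset.range (k + 1), (σ (u i)).length
        ≤ ∑ i ∈ Finset.range m, (σ (u i)).length :=
      Finset.sum_le_sum_of_subset (Finset.range_mono (by omega))
    have hm' : ∑ i ∈ Finset.range m, (σ (u i)).length ≤ n := hm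
    omega
  simp only [substApply, hk]

theorem exists_block {σ : Bool → List Bool} (hσ : Nonerasing σ) (u : ℕ → Bool) (n : ℕ) :
    ∃ k, ∑ i ∈ Finset.range k, (σ (u i)).length ≤ n ∧
      n < ∑ i ∈ Finset.range (k + 1), (σ (u i)).length := by
  have pos : ∀ b, 0 < (σ b).length := fun b => List.length_pos_iff.2 (hσ b)
  induction n with
  | zero => exact ⟨0, by simp, by simpa using pos (u 0)⟩
  | succ n ih =>
    obtain ⟨k, h₁, h₂⟩ := ih
    by_cases h : n + 1 < ∑ i ∈ Finset.range (k + 1), (σ (u i)).length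
    · exact ⟨k, by omega, h⟩
    · refine ⟨k + 1, by omega, ?_⟩
      rw [Finset.sum_range_succ]
      have := pos (u (k + 1))
      omega

theorem substApply_eq {σ : Bool → List Bool} (hσ : Nonerasing σ) (u : ℕ → Bool) :
    substApply σ u = appendW (σ (u 0)) (substApply σ (dropW 1 u)) := by
  funext n
  by_cases h : n < (σ (u 0)).length
  · rw [substApply_apply (k := 0) (by simp) (by simpa using h)]
    simp [appendW, h]
  · obtain ⟨k, h₁, h₂⟩ := exists_block hσ (dropW 1 u) (n - (σ (u 0)).length)
    have hsum : ∀ m, ∑ i ∈ Finset.range (m + 1), (σ (u i)).length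
        = ∑ i ∈ Finset.range m, (σ (dropW 1 u i)).length + (σ (u 0)).length := fun m =>
      Finset.sum_range_succ' _ m
    rw [substApply_apply (k := k + 1) (by rw [hsum]; omega) (by rw [hsum]; omega)]
    simp only [appendW, h, if_false]
    rw [substApply_apply h₁ h₂, hsum, Nat.sub_sub, Nat.add_comm (σ (u 0)).length]
    rfl

theorem substApply_dropW {σ : Bool → List Bool} (hσ : Nonerasing σ) (k : ℕ) (u : ℕ → Bool) :
    substApply σ (dropW k u) = appendW (σ (u k)) (substApply σ (dropW (k + 1) u)) := by
  rw [substApply_eq hσ, dropW_dropW, Nat.add_comm 1 k]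
  simp [dropW]

theorem substApply_consB {σ : Bool → List Bool} (hσ : Nonerasing σ) (b : Bool) (u : ℕ → Bool) :
    substApply σ (consB b u) = appendW (σ b) (substApply σ u) := by
  rw [substApply_eq hσ]
  rfl

theorem substApply_appendW {σ : Bool → List Bool} (hσ : Nonerasing σ) (p : List Bool)
    (u : ℕ → Bool) : substApply σ (appendW p u) = appendW (p.flatMap σ) (substApply σ u) := by
  induction p with
  | nil => simp [appendW_nil]
  | cons a p ih => rw [appendW_cons, substApply_consB hσ, ih, List.flatMap_cons, appendW_append]

/-- `substApply σ v` is determined by its factorization into blocks. -/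
theorem eq_substApply {σ : Bool → List Bool} (hσ : Nonerasing σ) {s : ℕ → ℕ → Bool}
    {v : ℕ → Bool} (h : ∀ k, s k = appendW (σ (v k)) (s (k + 1))) : s 0 = substApply σ v := by
  have key : ∀ n k, s k n = substApply σ (dropW k v) n := by
    intro n
    induction n using Nat.strong_induction_on with
    | _ n ih =>
      intro k
      rw [h, substApply_dropW hσ]
      simp only [appendW]
      split_ifs with hn
      · rfl
      · have := List.length_pos_iff.2 (hσ (v k))
        exact ih _ (by omega) _
  funext n
  exact key n 0

theorem exists_eq_substApply {σ : Bool → List Bool} (hσ : Nonerasing σ) {Q : (ℕ → Bool) → Prop}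
    (hQ : ∀ s, Q s → ∃ a t, s = appendW (σ a) t ∧ Q t) {u : ℕ → Bool} (hu : Q u) :
    ∃ v, u = substApply σ v := by
  choose a t ha ht using hQ
  let next : {s // Q s} → {s // Q s} := fun s => ⟨t s.1 s.2, ht s.1 s.2⟩
  let s : ℕ → {s // Q s} := fun k => next^[k] ⟨u, hu⟩
  refine ⟨fun k => a (s k).1 (s k).2, eq_substApply hσ (s := fun k => (s k).1) fun k => ?_⟩
  have : s (k + 1) = next (s k) := Function.iterate_succ_apply' _ _ _
  simp only [this]
  exact ha _ _

theorem Nonerasing.comp {σ τ : Bool → List Bool} (hσ : Nonerasing σ) (hτ : Nonerasing τ) :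
    Nonerasing (compSub σ τ) := by
  intro b h
  obtain ⟨c, l, hc⟩ := List.exists_cons_of_ne_nil (hτ b)
  simp [compSub, hc, hσ c] at h

theorem substApply_compSub {σ τ : Bool → List Bool} (hσ : Nonerasing σ) (hτ : Nonerasing τ)
    (u : ℕ → Bool) : substApply (compSub σ τ) u = substApply σ (substApply τ u) := by
  refine (eq_substApply (hσ.comp hτ) (s := fun k => substApply σ (substApply τ (dropW k u)))
    fun k => ?_).symm
  rw [substApply_dropW hτ, substApply_appendW hσ]
  rfl

theorem nonerasing_idSub : Nonerasing idSub := by simp [Nonerasing, idSub]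

theorem nonerasing_of_generator {ρ : Bool → List Bool} (h : ρ = Lsub ∨ ρ = Msub ∨ ρ = Rsub) :
    Nonerasing ρ := by
  rcases h with rfl | rfl | rfl <;> intro b <;> cases b <;> simp [Lsub, Msub, Rsub]

theorem nonerasing_Lsub : Nonerasing Lsub := nonerasing_of_generator (by simp)
theorem nonerasing_Msub : Nonerasing Msub := nonerasing_of_generator (by simp)
theorem nonerasing_Rsub : Nonerasing Rsub := nonerasing_of_generator (by simp)

theorem substApply_idSub (u : ℕ → Bool) : substApply idSub u = u := by
  refine (eq_substApply nonerasing_idSub (s := fun k => dropW k u) fun k => ?_).symm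
  rw [idSub, appendW_cons, appendW_nil]
  exact dropW_eq_consB k u

theorem Lsub_false (u : ℕ → Bool) :
    substApply Lsub (consB false u) = consB false (substApply Lsub u) := by
  simp [substApply_consB nonerasing_Lsub, Lsub, appendW_cons, appendW_nil]
theorem Lsub_true (u : ℕ → Bool) :
    substApply Lsub (consB true u) = consB false (consB true (substApply Lsub u)) := by
  simp [substApply_consB nonerasing_Lsub, Lsub, appendW_cons, appendW_nil]
theorem Msub_false (u : ℕ → Bool) :
    substApply Msub (consB false u) = consB false (consB true (substApply Msub u)) := by
  simp [substApply_consB nonerasing_Msub, Msub, appendW_cons, appendW_nil]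
theorem Msub_true (u : ℕ → Bool) :
    substApply Msub (consB true u) = consB true (consB false (substApply Msub u)) := by
  simp [substApply_consB nonerasing_Msub, Msub, appendW_cons, appendW_nil]
theorem Rsub_false (u : ℕ → Bool) :
    substApply Rsub (consB false u) = consB false (consB true (substApply Rsub u)) := by
  simp [substApply_consB nonerasing_Rsub, Rsub, appendW_cons, appendW_nil]
theorem Rsub_true (u : ℕ → Bool) :
    substApply Rsub (consB true u) = consB true (substApply Rsub u) := by
  simp [substApply_consB nonerasing_Rsub, Rsub, appendW_cons, appendW_nil]

/-- The suffixes of `σ(w)` start inside some block `σ(w_j)`. -/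
theorem dropW_substApply {σ : Bool → List Bool} (hσ : Nonerasing σ) (w : ℕ → Bool) (k : ℕ) :
    ∃ j s, s ≠ [] ∧ s <:+ σ (w j) ∧
      dropW k (substApply σ w) = appendW s (substApply σ (dropW (j + 1) w)) := by
  induction k with
  | zero => exact ⟨0, σ (w 0), hσ _, List.suffix_rfl, substApply_eq hσ w⟩
  | succ k ih =>
    obtain ⟨j, s, hs, hsuf, h⟩ := ih
    have hd : dropW (k + 1) (substApply σ w) = dropW 1 (dropW k (substApply σ w)) := by
      rw [dropW_dropW, Nat.add_comm]
    rw [hd, h]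
    obtain ⟨c, s, rfl⟩ := List.exists_cons_of_ne_nil hs
    rw [appendW_cons, dropW_succ_consB, dropW_zero]
    by_cases hs' : s = []
    · subst hs'
      exact ⟨j + 1, σ (w (j + 1)), hσ _, List.suffix_rfl, by
        rw [appendW_nil, substApply_dropW hσ]⟩
    · exact ⟨j, s, hs', (List.suffix_cons c s).trans hsuf, rfl⟩

theorem exists_dropW_substApply {σ : Bool → List Bool} (hσ : Nonerasing σ) (w : ℕ → Bool)
    (k : ℕ) : ∃ j, dropW j (substApply σ w) = substApply σ (dropW k w) := by
  obtain ⟨p, hp⟩ := exists_appendW_dropW k w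
  refine ⟨(p.flatMap σ).length, ?_⟩
  conv_lhs => rw [hp, substApply_appendW hσ]
  exact dropW_length_appendW _ _

theorem lexLt_appendW_self (p : List Bool) {u v : ℕ → Bool} (h : lexLt u v) :
    lexLt (appendW p u) (appendW p v) := by
  induction p with
  | nil => simpa only [appendW_nil] using h
  | cons a p ih => simpa only [appendW_cons, lexLt_consB_self] using ih

theorem lexLe_substApply_iff {ρ : Bool → List Bool} (h : ρ = Lsub ∨ ρ = Msub ∨ ρ = Rsub)
    {u v : ℕ → Bool} : lexLe (substApply ρ u) (substApply ρ v) ↔ lexLe u v := by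
  have hρ := nonerasing_of_generator h
  have base : ∀ x y, lexLt (substApply ρ (consB false x)) (substApply ρ (consB true y)) := by
    intro x y
    rcases h with rfl | rfl | rfl
    · rw [Lsub_false, Lsub_true, lexLt_consB_self, eq_consB x]
      cases x 0
      · rw [Lsub_false]; exact lexLt_false_true _ _
      · rw [Lsub_true]; exact lexLt_false_true _ _
    · rw [Msub_false, Msub_true]; exact lexLt_false_true _ _
    · rw [Rsub_false, Rsub_true]; exact lexLt_false_true _ _
  have mono : ∀ n : ℕ, ∀ u v : ℕ → Bool, (∀ i, i < n → u i = v i) → u n < v n →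
      lexLt (substApply ρ u) (substApply ρ v) := by
    intro n
    induction n with
    | zero =>
      intro u v _ h0
      rw [Bool.lt_iff] at h0
      rw [eq_consB u, eq_consB v, h0.1, h0.2]
      exact base _ _
    | succ n ih =>
      intro u v hi hn
      rw [eq_consB u, eq_consB v, hi 0 (by omega), substApply_consB hρ, substApply_consB hρ]
      exact lexLt_appendW_self _ (ih _ _ (fun i hin => hi (i + 1) (by omega)) hn)
  have mono' : ∀ {u v : ℕ → Bool}, lexLt u v → lexLt (substApply ρ u) (substApply ρ v) := by
    rintro u v ⟨n, hi, hn⟩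
    exact mono n u v hi hn
  constructor
  · intro hle
    by_contra hn
    exact not_lexLe.2 (mono' (not_lexLe.1 hn)) hle
  · rintro (hlt | rfl)
    · exact Or.inl (mono' hlt)
    · exact lexLe_refl _

theorem lexLe_Lsub_iff {u v : ℕ → Bool} :
    lexLe (substApply Lsub u) (substApply Lsub v) ↔ lexLe u v :=
  lexLe_substApply_iff (by simp)
theorem lexLe_Msub_iff {u v : ℕ → Bool} :
    lexLe (substApply Msub u) (substApply Msub v) ↔ lexLe u v :=
  lexLe_substApply_iff (by simp)
theorem lexLe_Rsub_iff {u v : ℕ → Bool} :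
    lexLe (substApply Rsub u) (substApply Rsub v) ↔ lexLe u v :=
  lexLe_substApply_iff (by simp)

/-! ### Suffixes of images under `L`, `M`, `R` -/

theorem dropW_Lsub (w : ℕ → Bool) (k : ℕ) :
    (∃ j, dropW k (substApply Lsub w) = substApply Lsub (dropW j w)) ∨
    ∃ j, w j = true ∧
      dropW k (substApply Lsub w) = consB true (substApply Lsub (dropW (j + 1) w)) := by
  obtain ⟨j, s, hs, hsuf, h⟩ := dropW_substApply nonerasing_Lsub w k
  cases hw : w j with
  | false =>
    refine Or.inl ⟨j, ?_⟩
    rw [h, substApply_dropW nonerasing_Lsub j]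
    simp only [hw, Lsub, Bool.false_eq_true, if_false, List.suffix_cons_iff, List.suffix_nil, hs,
      or_false] at hsuf
    rw [hsuf, hw]
    rfl
  | true =>
    simp only [hw, Lsub, if_true, List.suffix_cons_iff, List.suffix_nil, hs, or_false] at hsuf
    rcases hsuf with rfl | rfl
    · refine Or.inl ⟨j, ?_⟩
      rw [h, substApply_dropW nonerasing_Lsub j, hw]
      rfl
    · exact Or.inr ⟨j, hw, by rw [h, appendW_cons, appendW_nil]⟩

theorem dropW_Rsub (w : ℕ → Bool) (k : ℕ) :
    (∃ j, dropW k (substApply Rsub w) = substApply Rsub (dropW j w)) ∨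
    ∃ j, dropW k (substApply Rsub w) = consB true (substApply Rsub (dropW j w)) := by
  obtain ⟨j, s, hs, hsuf, h⟩ := dropW_substApply nonerasing_Rsub w k
  cases hw : w j with
  | true =>
    refine Or.inl ⟨j, ?_⟩
    rw [h, substApply_dropW nonerasing_Rsub j]
    simp only [hw, Rsub, if_true, List.suffix_cons_iff, List.suffix_nil, hs, or_false] at hsuf
    rw [hsuf, hw]
    rfl
  | false =>
    simp only [hw, Rsub, Bool.false_eq_true, if_false, List.suffix_cons_iff, List.suffix_nil, hs,
      or_false] at hsuf
    rcases hsuf with rfl | rfl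
    · refine Or.inl ⟨j, ?_⟩
      rw [h, substApply_dropW nonerasing_Rsub j, hw]
      rfl
    · exact Or.inr ⟨j + 1, by rw [h, appendW_cons, appendW_nil]⟩

theorem dropW_Msub (w : ℕ → Bool) (k : ℕ) :
    (∃ j, dropW k (substApply Msub w) = substApply Msub (dropW j w)) ∨
    ∃ c j, dropW k (substApply Msub w) = consB c (substApply Msub (dropW j w)) := by
  obtain ⟨j, s, hs, hsuf, h⟩ := dropW_substApply nonerasing_Msub w k
  have : s = Msub (w j) ∨ ∃ c, s = [c] := by
    cases hw : w j <;>
    · simp only [hw, Msub, Bool.false_eq_true, if_false, if_true, List.suffix_cons_iff,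
        List.suffix_nil, hs, or_false] at hsuf ⊢
      exact hsuf.imp_right fun h => ⟨_, h⟩
  rcases this with rfl | ⟨c, rfl⟩
  · exact Or.inl ⟨j, by rw [h, substApply_dropW nonerasing_Msub j]⟩
  · exact Or.inr ⟨c, j + 1, by rw [h, appendW_cons, appendW_nil]⟩

/-- All suffixes of `u` are at least `a`. -/
def OrbitGe (a u : ℕ → Bool) : Prop := ∀ k, lexLe a (dropW k u)
/-- All suffixes of `u` are at most `b`. -/
def OrbitLe (u b : ℕ → Bool) : Prop := ∀ k, lexLe (dropW k u) b

theorem OrbitGe.dropW {a u : ℕ → Bool} (h : OrbitGe a u) (j : ℕ) : OrbitGe a (dropW j u) :=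
  fun k => by rw [dropW_dropW]; exact h _

theorem OrbitLe.dropW {b u : ℕ → Bool} (h : OrbitLe u b) (j : ℕ) : OrbitLe (dropW j u) b :=
  fun k => by rw [dropW_dropW]; exact h _

theorem OrbitGe.tail {a u : ℕ → Bool} {c : Bool} (h : OrbitGe a (consB c u)) : OrbitGe a u :=
  h.dropW 1

theorem OrbitLe.tail {b u : ℕ → Bool} {c : Bool} (h : OrbitLe (consB c u) b) : OrbitLe u b :=
  h.dropW 1

section

variable {a b w : ℕ → Bool}

theorem OrbitGe.Lsub (h : OrbitGe (consB false a) w) :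
    OrbitGe (consB false (substApply Lsub a)) (substApply Lsub w) := by
  intro k
  rcases dropW_Lsub w k with ⟨j, hj⟩ | ⟨j, -, hj⟩ <;> rw [hj]
  · rw [← Lsub_false, lexLe_Lsub_iff]
    exact h j
  · exact lexLe_false_true _ _

theorem OrbitLe.Lsub (h : OrbitLe w (consB true b)) :
    OrbitLe (substApply Lsub w) (consB true (substApply Lsub b)) := by
  intro k
  rcases dropW_Lsub w k with ⟨j, hj⟩ | ⟨j, hw, hj⟩ <;> rw [hj]
  · rw [dropW_eq_consB]
    cases w j
    · rw [Lsub_false]; exact lexLe_false_true _ _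
    · rw [Lsub_true]; exact lexLe_false_true _ _
  · rw [lexLe_consB_self, lexLe_Lsub_iff]
    have := h j
    rwa [dropW_eq_consB, hw, lexLe_consB_self] at this

theorem OrbitGe.Rsub (h : OrbitGe (consB false a) w) :
    OrbitGe (consB false (consB true (substApply Rsub a))) (substApply Rsub w) := by
  intro k
  rcases dropW_Rsub w k with ⟨j, hj⟩ | ⟨j, hj⟩ <;> rw [hj]
  · rw [← Rsub_false, lexLe_Rsub_iff]
    exact h j
  · exact lexLe_false_true _ _

theorem OrbitLe.Rsub (h : OrbitLe w (consB true b)) :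
    OrbitLe (substApply Rsub w) (consB true (substApply Rsub (consB true b))) := by
  intro k
  rcases dropW_Rsub w k with ⟨j, hj⟩ | ⟨j, hj⟩ <;> rw [hj]
  · exact lexLe_trans (lexLe_Rsub_iff.2 (h j)) (lexLe_consB_true _)
  · rw [lexLe_consB_self, lexLe_Rsub_iff]
    exact h j

theorem OrbitGe.Msub (h : OrbitGe (consB false a) w) :
    OrbitGe (consB false (substApply Msub (consB false a))) (substApply Msub w) := by
  intro k
  rcases dropW_Msub w k with ⟨j, hj⟩ | ⟨c, j, hj⟩ <;> rw [hj]
  · exact lexLe_trans (consB_false_lexLe _) (lexLe_Msub_iff.2 (h j))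
  · cases c
    · rw [lexLe_consB_self, lexLe_Msub_iff]
      exact h j
    · exact lexLe_false_true _ _

theorem OrbitLe.Msub (h : OrbitLe w (consB true b)) :
    OrbitLe (substApply Msub w) (consB true (substApply Msub (consB true b))) := by
  intro k
  rcases dropW_Msub w k with ⟨j, hj⟩ | ⟨c, j, hj⟩ <;> rw [hj]
  · exact lexLe_trans (lexLe_Msub_iff.2 (h j)) (lexLe_consB_true _)
  · cases c
    · exact lexLe_false_true _ _
    · rw [lexLe_consB_self, lexLe_Msub_iff]
      exact h j

end

/-! ### Desubstitution -/

/-- The conclusion of the theorem: `u` ends with `σ(v)`, or with `σ'(0̄)` where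
`σ' ∈ {L,M,R}*M` is a left factor of `σ`. -/
def EndsWithSubst (σ : Bool → List Bool) (u : ℕ → Bool) : Prop :=
  (∃ p : List Bool, ∃ v : ℕ → Bool, u = appendW p (substApply σ v)) ∨
    (∃ τ' ∈ LMRstar, ∃ τ ∈ LMRstar, σ = compSub (compSub τ' Msub) τ ∧
      ∃ p : List Bool, u = appendW p (substApply (compSub τ' Msub) w0bar))

theorem compSub_assoc (ρ σ τ : Bool → List Bool) :
    compSub (compSub ρ σ) τ = compSub ρ (compSub σ τ) := by
  funext b
  simp only [compSub, List.flatMap_assoc]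
  rfl

theorem compSub_idSub_left (σ : Bool → List Bool) : compSub idSub σ = σ := by
  funext b
  exact List.flatMap_singleton' _

theorem compSub_mem_LMRstar {ρ σ : Bool → List Bool} (hρ : ρ = Lsub ∨ ρ = Msub ∨ ρ = Rsub)
    (hσ : σ ∈ LMRstar) : compSub ρ σ ∈ LMRstar := by
  obtain ⟨l, hl, rfl⟩ := hσ
  exact ⟨ρ :: l, by simpa [hρ] using hl, rfl⟩

theorem idSub_mem_LMRstar : idSub ∈ LMRstar := ⟨[], by simp, rfl⟩

theorem LMRstar_induction {P : (Bool → List Bool) → Prop} (hid : P idSub)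
    (hcomp : ∀ ρ σ, (ρ = Lsub ∨ ρ = Msub ∨ ρ = Rsub) → σ ∈ LMRstar → P σ → P (compSub ρ σ))
    {σ : Bool → List Bool} (hσ : σ ∈ LMRstar) : P σ := by
  obtain ⟨l, hl, rfl⟩ := hσ
  induction l with
  | nil => exact hid
  | cons ρ l ih =>
    have hl' : ∀ τ ∈ l, τ = Lsub ∨ τ = Msub ∨ τ = Rsub := fun τ hτ =>
      hl τ (List.mem_cons_of_mem _ hτ)
    exact hcomp _ _ (hl ρ List.mem_cons_self) ⟨l, hl', rfl⟩ (ih hl')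

theorem nonerasing_of_mem_LMRstar {σ : Bool → List Bool} (hσ : σ ∈ LMRstar) : Nonerasing σ :=
  LMRstar_induction nonerasing_idSub
    (fun _ _ hρ _ ih => (nonerasing_of_generator hρ).comp ih) hσ

theorem EndsWithSubst.appendW {σ : Bool → List Bool} {u : ℕ → Bool} (h : EndsWithSubst σ u)
    (q : List Bool) : EndsWithSubst σ (appendW q u) := by
  rcases h with ⟨p, v, rfl⟩ | ⟨τ', hτ', τ, hτ, e, p, rfl⟩
  · exact Or.inl ⟨q ++ p, v, (appendW_append _ _ _).symm⟩
  · exact Or.inr ⟨τ', hτ', τ, hτ, e, q ++ p, (appendW_append _ _ _).symm⟩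

theorem EndsWithSubst.comp {ρ σ : Bool → List Bool} {v : ℕ → Bool}
    (hρ : ρ = Lsub ∨ ρ = Msub ∨ ρ = Rsub) (hσ : σ ∈ LMRstar) (h : EndsWithSubst σ v) :
    EndsWithSubst (compSub ρ σ) (substApply ρ v) := by
  have hρ' := nonerasing_of_generator hρ
  rcases h with ⟨p, x, rfl⟩ | ⟨τ', hτ', τ, hτ, rfl, p, rfl⟩
  · refine Or.inl ⟨p.flatMap ρ, x, ?_⟩
    rw [substApply_appendW hρ', substApply_compSub hρ' (nonerasing_of_mem_LMRstar hσ)]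
  · refine Or.inr ⟨compSub ρ τ', compSub_mem_LMRstar hρ hτ', τ, hτ, ?_, p.flatMap ρ, ?_⟩
    · simp only [compSub_assoc]
    · rw [substApply_appendW hρ', compSub_assoc, substApply_compSub hρ'
        ((nonerasing_of_mem_LMRstar hτ').comp nonerasing_Msub)]

/-- If `u` ends with `ρ(v)` and `v` satisfies the conclusion for `σ`, so does `u` for `ρ ∘ σ`. -/
theorem EndsWithSubst.of_dropW {ρ σ : Bool → List Bool} {u v : ℕ → Bool} {k : ℕ}
    (hρ : ρ = Lsub ∨ ρ = Msub ∨ ρ = Rsub) (hσ : σ ∈ LMRstar) (hu : dropW k u = substApply ρ v)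
    (h : EndsWithSubst σ v) : EndsWithSubst (compSub ρ σ) u := by
  obtain ⟨p, hp⟩ := exists_appendW_dropW k u
  rw [hp, hu]
  exact (h.comp hρ hσ).appendW p

theorem exists_Lsub_desubstitution {a b u : ℕ → Bool}
    (hge : OrbitGe (consB false (substApply Lsub a)) u)
    (hle : OrbitLe u (consB true (substApply Lsub b))) :
    ∃ k v, dropW k u = substApply Lsub v ∧ OrbitGe (consB false a) v ∧
      OrbitLe v (consB true b) := by
  have zero_of : ∀ c : ℕ → Bool, ∃ d, substApply Lsub c = consB false d := by
    intro c
    rw [eq_consB c]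
    cases c 0
    · exact ⟨_, Lsub_false _⟩
    · exact ⟨_, Lsub_true _⟩
  have no11 : ∀ s, ¬ OrbitLe (consB true (consB true s)) (consB true (substApply Lsub b)) := by
    intro s h
    have := h 0
    obtain ⟨d, hd⟩ := zero_of b
    rw [dropW_zero, lexLe_consB_self, hd] at this
    exact not_lexLe_true_false _ _ this
  have parse : ∀ s, OrbitLe (consB false s) (consB true (substApply Lsub b)) →
      ∃ v, consB false s = substApply Lsub v := by
    intro s hs
    refine exists_eq_substApply nonerasing_Lsub
      (Q := fun x => (∃ y, x = consB false y) ∧ OrbitLe x (consB true (substApply Lsub b)))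
      ?_ ⟨⟨s, rfl⟩, hs⟩
    rintro x ⟨⟨y, rfl⟩, hx⟩
    rw [eq_consB y] at hx ⊢
    generalize dropW 1 y = z at hx ⊢
    cases hy : y 0 <;> rw [hy] at hx
    · exact ⟨false, _, by rw [Lsub]; simp [appendW_cons, appendW_nil], ⟨z, rfl⟩, hx.tail⟩
    · refine ⟨true, z, by rw [Lsub]; simp [appendW_cons, appendW_nil], ?_, hx.tail.tail⟩
      rw [eq_consB z] at hx ⊢
      cases hz : z 0
      · exact ⟨_, rfl⟩
      · rw [hz] at hx
        exact absurd hx.tail (no11 _)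
  have main : ∃ k v, dropW k u = substApply Lsub v := by
    cases h0 : u 0
    · refine ⟨0, ?_⟩
      rw [dropW_zero]
      rw [eq_consB u, h0] at hle ⊢
      exact parse _ hle
    · cases h1 : u 1
      · refine ⟨1, ?_⟩
        have := hle.dropW 1
        rw [dropW_eq_consB, h1] at this ⊢
        exact parse _ this
      · have := hle
        rw [eq_consB u, h0, dropW_eq_consB 1, h1] at this
        exact absurd this (no11 _)
  obtain ⟨k, v, hv⟩ := main
  have hge' := hge.dropW k
  have hle' := hle.dropW k
  rw [hv] at hge' hle'
  refine ⟨k, v, hv, fun i => ?_, fun i => ?_⟩ <;>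
    obtain ⟨j, hj⟩ := exists_dropW_substApply nonerasing_Lsub v i
  · rw [← lexLe_Lsub_iff, Lsub_false, ← hj]
    exact hge' j
  · have := hle'.dropW j
    rw [hj, dropW_eq_consB i] at this
    rw [dropW_eq_consB i]
    cases hvi : v i
    · exact lexLe_false_true _ _
    · rw [hvi, Lsub_true] at this
      have := this.tail 0
      rwa [dropW_zero, lexLe_consB_self, lexLe_Lsub_iff, ← lexLe_consB_self (b := true)] at this

theorem exists_Rsub_desubstitution {a b u : ℕ → Bool}
    (hge : OrbitGe (consB false (consB true (substApply Rsub a))) u)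
    (hle : OrbitLe u (consB true (substApply Rsub (consB true b)))) :
    ∃ k v, dropW k u = substApply Rsub v ∧ OrbitGe (consB false a) v ∧
      OrbitLe v (consB true b) := by
  have parse : ∃ v, u = substApply Rsub v := by
    refine exists_eq_substApply nonerasing_Rsub
      (Q := fun x => OrbitGe (consB false (consB true (substApply Rsub a))) x) ?_ hge
    intro x hx
    rw [eq_consB x] at hx ⊢
    cases hx0 : x 0 <;> rw [hx0] at hx
    · rw [dropW_eq_consB] at hx ⊢
      cases hx1 : x 1 <;> rw [hx1] at hx
      · have := hx 0
        rw [dropW_zero, lexLe_consB_self] at this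
        exact absurd this (not_lexLe_true_false _ _)
      · exact ⟨false, _, by rw [Rsub]; simp [appendW_cons, appendW_nil], hx.tail.tail⟩
    · exact ⟨true, _, by rw [Rsub]; simp [appendW_cons, appendW_nil], hx.tail⟩
  obtain ⟨v, rfl⟩ := parse
  obtain ⟨j₀, hj₀⟩ := exists_dropW_substApply nonerasing_Rsub v 1
  refine ⟨j₀, dropW 1 v, hj₀, fun i => ?_, fun i => ?_⟩ <;> rw [dropW_dropW]
  · obtain ⟨j, hj⟩ := exists_dropW_substApply nonerasing_Rsub v (i + 1)
    rw [← lexLe_Rsub_iff, Rsub_false, ← hj]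
    exact hge j
  · obtain ⟨j, hj⟩ := exists_dropW_substApply nonerasing_Rsub v i
    have := hle.dropW j
    rw [hj, dropW_eq_consB] at this
    rw [← lexLe_Rsub_iff, ← lexLe_consB_self (b := true)]
    cases hvi : v i <;> rw [hvi] at this
    · rw [Rsub_false] at this
      exact this.tail 0
    · rw [Rsub_true] at this
      exact this 0

theorem exists_Msub_parse {a b u : ℕ → Bool}
    (hge : OrbitGe (consB false (substApply Msub (consB false a))) u)
    (hle : OrbitLe u (consB true (substApply Msub (consB true b)))) :
    ∃ k v, dropW k u = substApply Msub v := by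
  by_cases halt : ∃ n, u n = u (n + 1)
  · obtain ⟨n, hn⟩ := halt
    have e0 : substApply Msub w0bar = consB false (consB true (substApply Msub w0bar)) := by
      rw [← Msub_false]; congr 1; exact eq_consB _
    have e1 : substApply Msub w1bar = consB true (consB false (substApply Msub w1bar)) := by
      rw [← Msub_true]; congr 1; exact eq_consB _
    have after0 : ∀ s, OrbitGe (consB false (substApply Msub (consB false a))) (consB false s) →
        lexLe (substApply Msub w0bar) s := by
      intro s hs
      have := hs 0
      rw [dropW_zero, lexLe_consB_self] at this
      exact lexLe_trans (lexLe_Msub_iff.2 (w0bar_lexLe _)) this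
    have after1 : ∀ s, OrbitLe (consB true s) (consB true (substApply Msub (consB true b))) →
        lexLe s (substApply Msub w1bar) := by
      intro s hs
      have := hs 0
      rw [dropW_zero, lexLe_consB_self] at this
      exact lexLe_trans this (lexLe_Msub_iff.2 (lexLe_w1bar _))
    refine ⟨n + 1, exists_eq_substApply nonerasing_Msub (Q := fun x =>
      (lexLe (substApply Msub w0bar) x ∧ lexLe x (substApply Msub w1bar)) ∧
      OrbitGe (consB false (substApply Msub (consB false a))) x ∧
      OrbitLe x (consB true (substApply Msub (consB true b)))) ?_
      ⟨?_, hge.dropW _, hle.dropW _⟩⟩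
    · rintro x ⟨⟨h0, h1⟩, hxge, hxle⟩
      obtain ⟨c, d, z, rfl⟩ : ∃ c d z, x = consB c (consB d z) :=
        ⟨x 0, x 1, dropW 2 x, by rw [← dropW_eq_consB, ← dropW_eq_consB, dropW_zero]⟩
      cases c
      · rw [e0, lexLe_consB_self] at h0
        cases d
        · exact absurd h0 (not_lexLe_true_false _ _)
        rw [lexLe_consB_self] at h0
        exact ⟨false, z, by rw [Msub]; simp [appendW_cons, appendW_nil],
          ⟨h0, after1 _ hxle.tail⟩, hxge.tail.tail, hxle.tail.tail⟩
      · rw [e1, lexLe_consB_self] at h1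
        cases d
        swap
        · exact absurd h1 (not_lexLe_true_false _ _)
        rw [lexLe_consB_self] at h1
        exact ⟨true, z, by rw [Msub]; simp [appendW_cons, appendW_nil],
          ⟨after0 _ hxge.tail, h1⟩, hxge.tail.tail, hxle.tail.tail⟩
    · have hge' := hge.dropW n
      have hle' := hle.dropW n
      rw [dropW_eq_consB, hn] at hge' hle'
      cases hu : u (n + 1) <;> rw [hu] at hge' hle'
      · refine ⟨after0 _ hge', ?_⟩
        rw [dropW_eq_consB, hu, e1]
        exact lexLe_false_true _ _
      · refine ⟨?_, after1 _ hle'⟩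
        rw [dropW_eq_consB, hu, e0]
        exact lexLe_false_true _ _
  · simp only [not_exists] at halt
    refine ⟨0, exists_eq_substApply nonerasing_Msub (Q := fun x => ∀ n, x n ≠ x (n + 1)) ?_ halt⟩
    intro x hx
    refine ⟨x 0, dropW 2 x, ?_, fun n => hx (n + 2)⟩
    conv_lhs => rw [eq_consB x, dropW_eq_consB]
    have := hx 0
    cases h0 : x 0 <;> cases h1 : x 1 <;>
      simp_all [Msub, appendW_cons, appendW_nil]

theorem exists_Msub_desubstitution {a b u : ℕ → Bool}
    (hge : OrbitGe (consB false (substApply Msub (consB false a))) u)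
    (hle : OrbitLe u (consB true (substApply Msub (consB true b)))) :
    (∃ k v, dropW k u = substApply Msub v ∧ OrbitGe (consB false a) v ∧
      OrbitLe v (consB true b)) ∨ ∃ p, u = appendW p (substApply Msub w0bar) := by
  obtain ⟨k, v, hv⟩ := exists_Msub_parse hge hle
  have hge' := hge.dropW k
  have hle' := hle.dropW k
  obtain ⟨p, hp⟩ := exists_appendW_dropW k u
  rw [hv] at hge' hle' hp
  by_cases h1 : ∃ i, v i = true
  swap
  · refine Or.inr ⟨p, ?_⟩
    have : v = w0bar := by funext i; simpa [w0bar] using fun h => h1 ⟨i, h⟩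
    rw [hp, this]
  by_cases h0 : ∃ i, v i = false
  swap
  · refine Or.inr ⟨p ++ [true], ?_⟩
    have : v = w1bar := by funext i; simpa [w1bar] using fun h => h0 ⟨i, h⟩
    rw [hp, this, appendW_append, appendW_cons, appendW_nil]
    congr 1
    refine (eq_substApply nonerasing_Msub (v := w1bar)
      (s := fun _ => consB true (substApply Msub w0bar)) fun k => ?_).symm
    have e0 : substApply Msub w0bar = consB false (consB true (substApply Msub w0bar)) := by
      rw [← Msub_false]; congr 1; exact eq_consB _
    conv_lhs => rw [e0]
    simp [w1bar, Msub, appendW_cons, appendW_nil]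
  obtain ⟨i, hi⟩ := h1
  obtain ⟨i', hi'⟩ := h0
  have after1 : ∀ k, v k = true → lexLe (consB false a) (dropW (k + 1) v) := by
    intro k hk
    obtain ⟨j, hj⟩ := exists_dropW_substApply nonerasing_Msub v k
    have := hge'.dropW j
    rw [hj, dropW_eq_consB, hk, Msub_true] at this
    have := this.tail 0
    rwa [dropW_zero, lexLe_consB_self, lexLe_Msub_iff] at this
  have after0 : ∀ k, v k = false → lexLe (dropW (k + 1) v) (consB true b) := by
    intro k hk
    obtain ⟨j, hj⟩ := exists_dropW_substApply nonerasing_Msub v k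
    have := hle'.dropW j
    rw [hj, dropW_eq_consB, hk, Msub_false] at this
    have := this.tail 0
    rwa [dropW_zero, lexLe_consB_self, lexLe_Msub_iff] at this
  have ge_of : ∀ k, i + 1 ≤ k → lexLe (consB false a) (dropW k v) := by
    intro k hk
    induction k, hk using Nat.le_induction with
    | base => exact after1 i hi
    | succ k _ ih =>
      cases hvk : v k
      · rw [dropW_eq_consB, hvk] at ih
        exact lexLe_trans ih (consB_false_lexLe _)
      · exact after1 k hvk
  have le_of : ∀ k, i' + 1 ≤ k → lexLe (dropW k v) (consB true b) := by
    intro k hk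
    induction k, hk using Nat.le_induction with
    | base => exact after0 i' hi'
    | succ k _ ih =>
      cases hvk : v k
      · exact after0 k hvk
      · rw [dropW_eq_consB, hvk] at ih
        exact lexLe_trans (lexLe_consB_true _) ih
  obtain ⟨j, hj⟩ := exists_dropW_substApply nonerasing_Msub v (i + i' + 1)
  refine Or.inl ⟨j + k, dropW (i + i' + 1) v, ?_, fun m => ?_, fun m => ?_⟩
  · rw [← dropW_dropW, hv, hj]
  · rw [dropW_dropW]; exact ge_of _ (by omega)
  · rw [dropW_dropW]; exact le_of _ (by omega)

/-- Words `0a` and `1b` bounding the orbits of `σ(1 0̄)` from below and of `σ(0 1̄)` from above,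
such that every word whose orbit lies between them satisfies the conclusion. -/
theorem exists_bounds {σ : Bool → List Bool} (hσ : σ ∈ LMRstar) :
    ∃ a b, OrbitGe (consB false a) (substApply σ w10bar) ∧
      OrbitLe (substApply σ w01bar) (consB true b) ∧
      ∀ u, OrbitGe (consB false a) u → OrbitLe u (consB true b) → EndsWithSubst σ u := by
  refine LMRstar_induction (P := fun σ => ∃ a b, OrbitGe (consB false a) (substApply σ w10bar) ∧
    OrbitLe (substApply σ w01bar) (consB true b) ∧
    ∀ u, OrbitGe (consB false a) u → OrbitLe u (consB true b) → EndsWithSubst σ u)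
    ?_ (fun ρ σ hρ hσ ih => ?_) hσ
  · refine ⟨w0bar, w1bar, fun k => ?_, fun k => ?_, fun u _ _ => Or.inl ⟨[], u, ?_⟩⟩
    · exact lexLe_trans (consB_false_lexLe _) (w0bar_lexLe _)
    · exact lexLe_trans (lexLe_w1bar _) (lexLe_consB_true _)
    · rw [substApply_idSub, appendW_nil]
  · obtain ⟨a, b, hge, hle, h⟩ := ih
    rw [substApply_compSub (nonerasing_of_generator hρ) (nonerasing_of_mem_LMRstar hσ),
      substApply_compSub (nonerasing_of_generator hρ) (nonerasing_of_mem_LMRstar hσ)]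
    rcases hρ with rfl | rfl | rfl
    · refine ⟨_, _, hge.Lsub, hle.Lsub, fun u hu hu' => ?_⟩
      obtain ⟨k, v, hv, hv₀, hv₁⟩ := exists_Lsub_desubstitution hu hu'
      exact .of_dropW (by simp) hσ hv (h v hv₀ hv₁)
    · refine ⟨_, _, hge.Msub, hle.Msub, fun u hu hu' => ?_⟩
      rcases exists_Msub_desubstitution hu hu' with ⟨k, v, hv, hv₀, hv₁⟩ | ⟨p, hp⟩
      · exact .of_dropW (by simp) hσ hv (h v hv₀ hv₁)
      · exact Or.inr ⟨idSub, idSub_mem_LMRstar, σ, hσ, by rw [compSub_idSub_left], p, by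
          rw [compSub_idSub_left, hp]⟩
    · refine ⟨_, _, hge.Rsub, hle.Rsub, fun u hu hu' => ?_⟩
      obtain ⟨k, v, hv, hv₀, hv₁⟩ := exists_Rsub_desubstitution hu hu'
      exact .of_dropW (by simp) hσ hv (h v hv₀ hv₁)

/-- If `inf O(u) ≥ inf O(σ(1 0̄))` and `sup O(u) ≤ sup O(σ(0 1̄))`, then `u` ends with `σ(v)`
for some infinite word `v`, or `u` ends with `σ'(0̄)` for some `σ' ∈ {L,M,R}*M` with
`σ = σ' ∘ τ`, `τ ∈ {L,M,R}*`. -/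
theorem ends_with_subst (u : ℕ → Bool) (σ : Bool → List Bool) (hσ : σ ∈ LMRstar)
    (hinf : lexLe (infO (substApply σ w10bar)) (infO u))
    (hsup : lexLe (supO u) (supO (substApply σ w01bar))) :
    (∃ p : List Bool, ∃ v : ℕ → Bool, u = appendW p (substApply σ v)) ∨
    (∃ τ' ∈ LMRstar, ∃ τ ∈ LMRstar, σ = compSub (compSub τ' Msub) τ ∧
      ∃ p : List Bool, u = appendW p (substApply (compSub τ' Msub) w0bar)) := by
  obtain ⟨a, b, hge, hle, h⟩ := exists_bounds hσ
  exact h u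
    (fun k => lexLe_trans (lexLe_infO hge) (lexLe_trans hinf (infO_lexLe_dropW u k)))
    (fun k => lexLe_trans (dropW_lexLe_supO u k) (lexLe_trans hsup (supO_lexLe hle)))
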